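/- Let a and N be natural numbers and let K be a closed subset of ([0,1]^a)^N. Define the block-system X(K) = { x ∈ ([0,1]^a)^ℤ : there exists ℓ ∈ ℤ such that for all n ∈ ℤ, (x_{ℓ+nN}, x_{ℓ+nN+1}, …, x_{ℓ+(n+1)N−1}) ∈ K }, a shift-invariant closed subset of ([0,1]^a)^ℤ. Then the upper metric mean dimension of (X(K), σ) with respect to the metric D satisfies upper-mdim_M(X(K), σ, D) ≤ upper-dim_M(K, ‖·‖_∞)/N, where upper-dim_M(K, ‖·‖_∞) is the upper Minkowski dimension of K with respect to the ℓ^∞-norm. -/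

import Mathlib

open Filter Topology
open scoped ENNReal NNReal

noncomputable section

/-- Diameter (in `ℝ≥0∞`) of a set with respect to a distance function `ρ`. -/
def setEDiam {X : Type*} (ρ : X → X → ℝ) (E : Set X) : ℝ≥0∞ :=
  ⨆ x ∈ E, ⨆ y ∈ E, ENNReal.ofReal (ρ x y)

/-- Openness with respect to a distance function `ρ`. -/
def ROpen {X : Type*} (ρ : X → X → ℝ) (U : Set X) : Prop :=
  ∀ x ∈ U, ∃ δ > 0, ∀ y, ρ x y < δ → y ∈ U

/-- `#(E, ρ, ε)`: the minimal number `n` of `ρ`-open sets of `ρ`-diameter `< ε` covering `E`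
(`0` when `E = ∅`, since the empty family covers it). -/
def covNum {X : Type*} (ρ : X → X → ℝ) (ε : ℝ) (E : Set X) : ℕ :=
  sInf {n : ℕ | ∃ U : Fin n → Set X, (∀ i, ROpen ρ (U i)) ∧
    (∀ i, setEDiam ρ (U i) < ENNReal.ofReal ε) ∧ E ⊆ ⋃ i, U i}

/-- The dynamical metric `d_N(x,y) = max_{0 ≤ n < N} d(Tⁿx, Tⁿy)`. -/
def dynDist {X : Type*} (T : X → X) (d : X → X → ℝ) (N : ℕ) (x y : X) : ℝ :=
  sSup {r : ℝ | ∃ n, n < N ∧ r = d (T^[n] x) (T^[n] y)}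

/-- `sup_{y ∈ Y} log #(π⁻¹(y), ρ, ε)`. -/
def supLogCov {X Y : Type*} (π : X → Y) (ρ : X → X → ℝ) (ε : ℝ) : ℝ :=
  ⨆ y : Y, Real.log (covNum ρ ε (π ⁻¹' {y}) : ℝ)

/-- `sup_{y ∈ Y} log #(π⁻¹(B_δ(y, ρY)), ρX, ε)` where `B_δ` is the closed `δ`-ball. -/
def supLogCovBall {X Y : Type*} (π : X → Y) (ρX : X → X → ℝ) (ρY : Y → Y → ℝ)
    (ε δ : ℝ) : ℝ :=
  ⨆ y : Y, Real.log (covNum ρX ε (π ⁻¹' {x | ρY x y ≤ δ}) : ℝ)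

/-- Topological conditional entropy
`h_top(π, T) = lim_{ε→0} lim_{N→∞} (sup_y log #(π⁻¹(y), d_N, ε))/N`, as an extended real. -/
def condEntropy {X Y : Type*} (π : X → Y) (T : X → X) (d : X → X → ℝ) : EReal :=
  Filter.limsup (fun ε : ℝ => Filter.liminf
      (fun N : ℕ => ((supLogCov π (dynDist T d N) ε / N : ℝ) : EReal)) Filter.atTop)
    (𝓝[>] (0 : ℝ))

/-- `lim_{N→∞} (sup_y log #(π⁻¹(y), d_N, ε))/(N log(1/ε))` (the limit exists by
subadditivity; it is realized here as a liminf). -/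
def condMdimRate {X Y : Type*} (π : X → Y) (T : X → X) (d : X → X → ℝ) (ε : ℝ) : EReal :=
  Filter.liminf (fun N : ℕ =>
    ((supLogCov π (dynDist T d N) ε / (N * Real.log (1 / ε)) : ℝ) : EReal)) Filter.atTop

/-- Lower conditional metric mean dimension of `π : (X,T,d) → Y`. -/
def lowerCondMdimM {X Y : Type*} (π : X → Y) (T : X → X) (d : X → X → ℝ) : EReal :=
  Filter.liminf (fun ε : ℝ => condMdimRate π T d ε) (𝓝[>] (0 : ℝ))

/-- Upper conditional metric mean dimension of `π : (X,T,d) → Y`. -/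
def upperCondMdimM {X Y : Type*} (π : X → Y) (T : X → X) (d : X → X → ℝ) : EReal :=
  Filter.limsup (fun ε : ℝ => condMdimRate π T d ε) (𝓝[>] (0 : ℝ))

/-- `lim_{N→∞} log #(X, d_N, ε)/(N log(1/ε))`. -/
def mdimMRate {X : Type*} (T : X → X) (d : X → X → ℝ) (ε : ℝ) : EReal :=
  Filter.liminf (fun N : ℕ =>
    ((Real.log (covNum (dynDist T d N) ε (Set.univ : Set X) : ℝ) /
      (N * Real.log (1 / ε)) : ℝ) : EReal)) Filter.atTop

/-- Lower metric mean dimension of `(X, T, d)`. -/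
def lowerMdimM {X : Type*} (T : X → X) (d : X → X → ℝ) : EReal :=
  Filter.liminf (fun ε : ℝ => mdimMRate T d ε) (𝓝[>] (0 : ℝ))

/-- Upper metric mean dimension of `(X, T, d)`. -/
def upperMdimM {X : Type*} (T : X → X) (d : X → X → ℝ) : EReal :=
  Filter.limsup (fun ε : ℝ => mdimMRate T d ε) (𝓝[>] (0 : ℝ))

/-- `widim_ε(X, ρ)`: the minimal `k` such that there are a finite simplicial complex of
dimension `≤ k` (realized in some `ℝ^m`) and a continuous `ε`-embedding `f : X → P`
(all fibers of `f` have `ρ`-diameter `< ε`). -/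
def widim (X : Type*) [TopologicalSpace X] (ρ : X → X → ℝ) (ε : ℝ) : ℕ :=
  sInf {k : ℕ | ∃ (m : ℕ) (K : Geometry.SimplicialComplex ℝ (Fin m → ℝ)),
    K.faces.Finite ∧ (∀ s ∈ K.faces, s.card ≤ k + 1) ∧
    ∃ f : X → K.space, Continuous f ∧
      ∀ p : K.space, setEDiam ρ (f ⁻¹' {p}) < ENNReal.ofReal ε}

/-- Mean dimension `mdim(X, T) = lim_{ε→0} lim_{N→∞} widim_ε(X, d_N)/N`. -/
def mdim (X : Type*) [TopologicalSpace X] (T : X → X) (d : X → X → ℝ) : EReal :=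
  Filter.limsup (fun ε : ℝ => Filter.liminf
      (fun N : ℕ => (((widim X (dynDist T d N) ε : ℝ) / N : ℝ) : EReal)) Filter.atTop)
    (𝓝[>] (0 : ℝ))

/-- The cube `[0,1]^a`. -/
abbrev Cube (a : ℕ) := Fin a → unitInterval

/-- The full shift space `([0,1]^a)^ℤ`. -/
abbrev FullShift (a : ℕ) := ℤ → Cube a

/-- The shift map `σ((x_n)_n) = (x_{n+1})_n`. -/
def shift {α : Type*} (x : ℤ → α) : ℤ → α := fun n => x (n + 1)

/-- The `ℓ^∞`-distance on the cube `[0,1]^a`. -/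
def cubeDist {a : ℕ} (x y : Cube a) : ℝ :=
  ‖(fun i => (x i : ℝ)) - fun i => (y i : ℝ)‖

/-- The metric `D((x_n), (y_n)) = Σ_{n∈ℤ} 2^{-|n|} ‖x_n − y_n‖_∞` on the full shift. -/
def shiftDist {a : ℕ} (x y : FullShift a) : ℝ :=
  ∑' n : ℤ, (2 : ℝ) ^ (-|n|) * cubeDist (x n) (y n)

end

/-- The cube distance is the ambient (sup) distance of the pi type. -/
theorem cubeDist_eq_dist {a : ℕ} (x y : Cube a) : cubeDist x y = dist x y := by
  have h : Isometry fun (z : Cube a) (i : Fin a) => (z i : ℝ) :=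
    Isometry.piMap (fun _ (t : unitInterval) => (t : ℝ)) fun _ => isometry_subtype_coe
  rw [cubeDist, ← dist_eq_norm]
  exact h.dist_eq x y

/-- The `ℓ^∞`-distance of blocks is the ambient (sup) distance of the pi type. -/
theorem norm_block_sub_eq_dist {a N : ℕ} (u v : Fin N → Cube a) :
    ‖(fun i j => ((u i j : ℝ))) - (fun i j => ((v i j : ℝ)))‖ = dist u v := by
  have h : Isometry fun (z : Fin N → Cube a) (i : Fin N) (j : Fin a) => (z i j : ℝ) :=
    Isometry.piMap (fun _ (z : Cube a) (j : Fin a) => (z j : ℝ)) fun _ =>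
      Isometry.piMap (fun _ (t : unitInterval) => (t : ℝ)) fun _ => isometry_subtype_coe
  rw [← dist_eq_norm]
  exact h.dist_eq u v

theorem cubeDist_nonneg {a : ℕ} (x y : Cube a) : 0 ≤ cubeDist x y := norm_nonneg _

theorem cubeDist_le_one {a : ℕ} (x y : Cube a) : cubeDist x y ≤ 1 := by
  rw [cubeDist_eq_dist, dist_pi_le_iff zero_le_one]
  exact fun i => Real.dist_le_of_mem_Icc_01 (x i).2 (y i).2

theorem summable_two_zpow_neg_abs : Summable fun n : ℤ => (2 : ℝ) ^ (-|n|) := by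
  have h : Summable fun n : ℕ => (2 : ℝ) ^ (-(n : ℤ)) := by
    simpa [zpow_neg, inv_pow] using summable_geometric_two
  apply Summable.of_nat_of_neg <;> simpa using h

theorem summable_shiftDist {a : ℕ} (x y : FullShift a) :
    Summable fun n : ℤ => (2 : ℝ) ^ (-|n|) * cubeDist (x n) (y n) := by
  refine Summable.of_nonneg_of_le (fun n => ?_) (fun n => ?_) summable_two_zpow_neg_abs
  · exact mul_nonneg (by positivity) (cubeDist_nonneg _ _)
  · exact mul_le_of_le_one_right (by positivity) (cubeDist_le_one _ _)

theorem shiftDist_nonneg {a : ℕ} (x y : FullShift a) : 0 ≤ shiftDist x y :=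
  tsum_nonneg fun _ => mul_nonneg (by positivity) (cubeDist_nonneg _ _)

theorem cubeDist_le_two_pow_mul_shiftDist {a : ℕ} (x y : FullShift a) (k : ℤ) :
    cubeDist (x k) (y k) ≤ 2 ^ |k| * shiftDist x y := by
  have h := (summable_shiftDist x y).le_tsum k
    fun _ _ => mul_nonneg (by positivity) (cubeDist_nonneg _ _)
  rw [zpow_neg, inv_mul_le_iff₀ (by positivity)] at h
  exact h

/-- Up to a constant factor, closeness in the shift metric is implied by closeness of finitely
many coordinates. -/
theorem exists_shiftDist_le : ∃ c : ℝ, 0 < c ∧ ∀ ε : ℝ, 0 < ε → ∃ M : ℕ, ∀ (a : ℕ)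
    (x y : FullShift a), (∀ k : ℤ, |k| ≤ M → cubeDist (x k) (y k) ≤ c * ε) →
      shiftDist x y ≤ 3 / 4 * ε := by
  set g : ℤ → ℝ := fun n => (2 : ℝ) ^ (-|n|) with hg
  have hgs : Summable g := summable_two_zpow_neg_abs
  have hg0 : ∀ n, 0 ≤ g n := fun n => by positivity
  have hC : 0 ≤ ∑' n, g n := tsum_nonneg hg0
  refine ⟨1 / (2 * (∑' n, g n + 1)), by positivity, fun ε hε => ?_⟩
  obtain ⟨S, hS⟩ : ∃ S : Finset ℤ, ∑' n : {n // n ∉ S}, g n < ε / 4 :=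
    ((tendsto_order.1 (tendsto_tsum_compl_atTop_zero g)).2 _ (by positivity)).exists
  obtain ⟨M, hM⟩ : ∃ M : ℕ, ∀ k ∈ S, |k| ≤ (M : ℤ) := by
    refine ⟨S.sup fun k => k.natAbs, fun k hk => ?_⟩
    rw [Int.abs_eq_natAbs]
    exact_mod_cast Finset.le_sup (f := fun k : ℤ => k.natAbs) hk
  refine ⟨M, fun a x y h => ?_⟩
  set r : ℝ := 1 / (2 * (∑' n, g n + 1)) * ε with hr
  have hr0 : 0 ≤ r := by positivity
  have hind : Summable (Set.indicator {n | n ∉ S} g) := hgs.indicator _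
  calc shiftDist x y ≤ ∑' n, (g n * r + Set.indicator {n | n ∉ S} g n) := by
        refine (summable_shiftDist x y).tsum_le_tsum (fun n => ?_) ((hgs.mul_right r).add hind)
        by_cases hn : n ∈ S
        · rw [Set.indicator_of_notMem (by simpa using hn), add_zero]
          exact mul_le_mul_of_nonneg_left (h n (hM n hn)) (hg0 n)
        · rw [Set.indicator_of_mem (by simpa using hn)]
          have := mul_le_of_le_one_right (hg0 n) (cubeDist_le_one (x n) (y n))
          have := mul_nonneg (hg0 n) hr0
          linarith
    _ = (∑' n, g n) * r + ∑' n : {n // n ∉ S}, g n := by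
        rw [(hgs.mul_right r).tsum_add hind, tsum_mul_right, ← tsum_subtype]
        rfl
    _ ≤ 3 / 4 * ε := by
        have h1 : (∑' n, g n) * r ≤ ε / 2 := by
          rw [hr, ← mul_assoc]
          have : (∑' n, g n) * (1 / (2 * (∑' n, g n + 1))) ≤ 1 / 2 := by
            rw [mul_one_div, div_le_div_iff₀ (by positivity) (by positivity)]
            linarith
          nlinarith
        linarith

theorem le_dynDist {X : Type*} (T : X → X) (d : X → X → ℝ) {L : ℕ} (hL : 0 < L) (x y : X) :
    d x y ≤ dynDist T d L x y := by
  refine le_csSup (Set.Finite.bddAbove ?_) ⟨0, hL, rfl⟩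
  refine ((Set.finite_lt_nat L).image fun n => d (T^[n] x) (T^[n] y)).subset ?_
  rintro r ⟨n, hn, rfl⟩
  exact ⟨n, hn, rfl⟩

/-- Any finite family of admissible open sets bounds the covering number. -/
theorem covNum_le_card {X ι : Type*} [Fintype ι] {ρ : X → X → ℝ} {ε : ℝ} {E : Set X}
    (U : ι → Set X) (ho : ∀ i, ROpen ρ (U i)) (hd : ∀ i, setEDiam ρ (U i) < ENNReal.ofReal ε)
    (hE : E ⊆ ⋃ i, U i) : covNum ρ ε E ≤ Fintype.card ι := by
  refine Nat.sInf_le ⟨fun i => U ((Fintype.equivFin ι).symm i), fun _ => ho _, fun _ => hd _,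
    fun x hx => ?_⟩
  obtain ⟨i, hi⟩ := Set.mem_iUnion.1 (hE hx)
  exact Set.mem_iUnion.2 ⟨Fintype.equivFin ι i, by simpa using hi⟩

theorem lt_of_setEDiam_lt {X : Type*} {ρ : X → X → ℝ} {E : Set X} {ε : ℝ}
    (h : setEDiam ρ E < ENNReal.ofReal ε) {x y : X} (hx : x ∈ E) (hy : y ∈ E) : ρ x y < ε := by
  have h1 : ENNReal.ofReal (ρ x y) ≤ setEDiam ρ E :=
    (le_iSup₂ (f := fun y (_ : y ∈ E) => ENNReal.ofReal (ρ x y)) y hy).trans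
      (le_iSup₂ (f := fun x (_ : x ∈ E) => ⨆ y ∈ E, ENNReal.ofReal (ρ x y)) x hx)
  exact lt_of_not_ge fun h2 => (h1.trans_lt h).not_ge (ENNReal.ofReal_le_ofReal h2)

theorem setEDiam_lt_of_forall_le {X : Type*} {ρ : X → X → ℝ} {E : Set X} {r ε : ℝ} (hε : 0 < ε)
    (hr : r < ε) (h : ∀ x ∈ E, ∀ y ∈ E, ρ x y ≤ r) : setEDiam ρ E < ENNReal.ofReal ε := by
  refine lt_of_le_of_lt ?_ ((ENNReal.ofReal_lt_ofReal_iff hε).2 hr)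
  exact iSup₂_le fun x hx => iSup₂_le fun y hy => ENNReal.ofReal_le_ofReal (h x hx y hy)

/-- On a compact set the covering number is attained. -/
theorem exists_cover_covNum {X : Type*} [PseudoMetricSpace X] {K : Set X} (hK : IsCompact K)
    {ε : ℝ} (hε : 0 < ε) : ∃ U : Fin (covNum (fun x y : X => dist x y) ε K) → Set X,
      (∀ i, IsOpen (U i)) ∧ (∀ i, ∀ x ∈ U i, ∀ y ∈ U i, dist x y < ε) ∧ K ⊆ ⋃ i, U i := by
  have hne : {n : ℕ | ∃ U : Fin n → Set X, (∀ i, ROpen (fun x y : X => dist x y) (U i)) ∧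
      (∀ i, setEDiam (fun x y : X => dist x y) (U i) < ENNReal.ofReal ε) ∧
        K ⊆ ⋃ i, U i}.Nonempty := by
    obtain ⟨t, -, ht, hcov⟩ := hK.finite_cover_balls (e := ε / 3) (by positivity)
    have := ht.fintype
    refine ⟨Fintype.card t, fun i => Metric.ball ((Fintype.equivFin t).symm i : X) (ε / 3),
      fun i x hx => ?_, fun i => ?_, fun x hx => ?_⟩
    · obtain ⟨δ, hδ, h⟩ := Metric.isOpen_iff.1 Metric.isOpen_ball x hx
      exact ⟨δ, hδ, fun y hy => h (by rwa [Metric.mem_ball, dist_comm])⟩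
    · refine setEDiam_lt_of_forall_le (r := 2 * ε / 3) hε (by linarith) fun x hx y hy => ?_
      have := dist_triangle_right x y ((Fintype.equivFin t).symm i : X)
      rw [Metric.mem_ball] at hx hy
      linarith
    · obtain ⟨z, hz, hxz⟩ := Set.mem_iUnion₂.1 (hcov hx)
      exact Set.mem_iUnion.2 ⟨Fintype.equivFin t ⟨z, hz⟩, by simpa using hxz⟩
  obtain ⟨U, ho, hd, hU⟩ := Nat.sInf_mem hne
  refine ⟨U, fun i => Metric.isOpen_iff.2 fun x hx => ?_,
    fun i x hx y hy => lt_of_setEDiam_lt (hd i) hx hy, hU⟩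
  obtain ⟨δ, hδ, h⟩ := ho i x hx
  exact ⟨δ, hδ, fun y hy => h y (by rwa [Metric.mem_ball, dist_comm] at hy)⟩

theorem iterate_shift_apply {a : ℕ} {XK : Set (FullShift a)} {T : XK → XK}
    (hT : ∀ x : XK, (T x : FullShift a) = shift (x : FullShift a)) (n : ℕ) (x : XK) (k : ℤ) :
    (T^[n] x : FullShift a) k = (x : FullShift a) (k + n) := by
  induction n generalizing k with
  | zero => simp
  | succ n ih =>
    have h : k + 1 + (n : ℤ) = k + (n + 1 : ℕ) := by
      push_cast
      ring
    rw [Function.iterate_succ_apply', hT, shift, ih, h]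

/-- Membership of finitely many blocks in open sets is an open condition for the dynamical
metrics. -/
theorem rOpen_setOf_forall_block_mem {a N : ℕ} {XK : Set (FullShift a)} (T : XK → XK) {L : ℕ}
    (hL : 0 < L) {ι : Type*} [Finite ι] (s : ι → ℤ) (U : ι → Set (Fin N → Cube a))
    (hU : ∀ i, IsOpen (U i)) :
    ROpen (dynDist T (fun x y : XK => shiftDist (x : FullShift a) (y : FullShift a)) L)
      {x : XK | ∀ n, (fun i : Fin N => (x : FullShift a) (s n + (i : ℤ))) ∈ U n} := by
  intro x hx
  have key : ∀ n, ∀ᶠ δ : ℝ in 𝓝[>] 0, ∀ y : XK,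
      shiftDist (x : FullShift a) (y : FullShift a) < δ →
        (fun i : Fin N => (y : FullShift a) (s n + (i : ℤ))) ∈ U n := by
    intro n
    obtain ⟨η, hη, hball⟩ := Metric.isOpen_iff.1 (hU n) _ (hx n)
    have hi : ∀ i : Fin N, ∀ᶠ δ : ℝ in 𝓝[>] 0, (2 : ℝ) ^ |s n + (i : ℤ)| * δ < η := by
      intro i
      have : Tendsto (fun δ : ℝ => (2 : ℝ) ^ |s n + (i : ℤ)| * δ) (𝓝[>] 0) (𝓝 0) := by
        have h : Tendsto (fun δ : ℝ => (2 : ℝ) ^ |s n + (i : ℤ)| * δ) (𝓝 0)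
            (𝓝 ((2 : ℝ) ^ |s n + (i : ℤ)| * 0)) := tendsto_id.const_mul _
        rw [mul_zero] at h
        exact h.mono_left nhdsWithin_le_nhds
      exact (tendsto_order.1 this).2 _ hη
    filter_upwards [eventually_all.2 hi] with δ hδ y hy
    refine hball ?_
    rw [Metric.mem_ball, dist_comm, dist_pi_lt_iff hη]
    intro i
    rw [← cubeDist_eq_dist]
    refine (cubeDist_le_two_pow_mul_shiftDist _ _ _).trans_lt (lt_of_le_of_lt ?_ (hδ i))
    exact mul_le_mul_of_nonneg_left hy.le (by positivity)
  obtain ⟨δ, hδ, hδ0⟩ := ((eventually_all.2 key).and self_mem_nhdsWithin).exists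
  exact ⟨δ, hδ0, fun y hy n => hδ n y (lt_of_le_of_lt (le_dynDist T
    (fun x y : XK => shiftDist (x : FullShift a) (y : FullShift a)) hL x y) hy)⟩

/-- Covering number bound for a block system in terms of the covering number of its blocks. -/
theorem covNum_blockSystem_le {a N : ℕ} (hN : 0 < N) {K : Set (Fin N → Cube a)}
    (hK : IsCompact K) {XK : Set (FullShift a)}
    (hXK : XK = {x : FullShift a | ∃ ℓ : ℤ, ∀ n : ℤ,
      (fun i : Fin N => x (ℓ + n * (N : ℤ) + (i : ℤ))) ∈ K})
    {T : XK → XK} (hT : ∀ x : XK, (T x : FullShift a) = shift (x : FullShift a))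
    {ε η : ℝ} (hε : 0 < ε) (hη : 0 < η) {M : ℕ}
    (hM : ∀ x y : FullShift a, (∀ k : ℤ, |k| ≤ M → cubeDist (x k) (y k) ≤ η) →
      shiftDist x y ≤ 3 / 4 * ε) {L : ℕ} (hL : 0 < L) :
    covNum (dynDist T (fun x y : XK => shiftDist (x : FullShift a) (y : FullShift a)) L) ε
      Set.univ ≤ N * covNum (fun u v : Fin N → Cube a => dist u v) η K ^ (L / N + 2 * M + 2) := by
  have hcover := exists_cover_covNum hK hη
  generalize covNum (fun u v : Fin N → Cube a => dist u v) η K = P at hcover ⊢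
  obtain ⟨U, hUo, hUd, hUK⟩ := hcover
  set B := L / N + 2 * M + 2 with hB
  have hcard : Fintype.card (Fin N × (Fin B → Fin P)) = N * P ^ B := by simp
  rw [← hcard]
  have hN' : (0 : ℤ) < N := by exact_mod_cast hN
  refine covNum_le_card (fun p : Fin N × (Fin B → Fin P) => {x : XK | ∀ n : Fin B,
    (fun i : Fin N => (x : FullShift a) (((p.1 : ℤ) + ((n : ℤ) - (M + 1)) * N) + (i : ℤ))) ∈
      U (p.2 n)}) (fun p => ?_) (fun p => ?_) (fun x _ => ?_)
  · exact rOpen_setOf_forall_block_mem T hL (fun n : Fin B => (p.1 : ℤ) + ((n : ℤ) - (M + 1)) * N)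
      (fun n => U (p.2 n)) fun n => hUo _
  · refine setEDiam_lt_of_forall_le (r := 3 / 4 * ε) hε (by linarith) fun x hx y hy => ?_
    refine Real.sSup_le ?_ (by positivity)
    rintro r ⟨m, hm, rfl⟩
    refine hM _ _ fun k hk => ?_
    rw [iterate_shift_apply hT, iterate_shift_apply hT]
    obtain ⟨hk1, hk2⟩ := abs_le.1 hk
    set q : ℤ := k + m - p.1 + (M + 1) * N with hq
    have hp0 : (p.1 : ℤ) < N := by exact_mod_cast p.1.2
    have hq0 : 0 ≤ q := by nlinarith
    have hLN : (L : ℤ) < (L / N : ℕ) * N + N := by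
      have := Nat.lt_div_mul_add hN (a := L)
      exact_mod_cast this
    have hqB : q < B * N := by
      rw [hB]
      push_cast at hLN ⊢
      have : (m : ℤ) < L := by exact_mod_cast hm
      nlinarith
    have hdiv : q / N < B := Int.ediv_lt_of_lt_mul hN' hqB
    have hdiv0 : 0 ≤ q / N := Int.ediv_nonneg hq0 hN'.le
    have hmod : q % N < N := Int.emod_lt_of_pos _ hN'
    have hmod0 : 0 ≤ q % N := Int.emod_nonneg _ hN'.ne'
    let n : Fin B := ⟨(q / N).toNat, by omega⟩
    let i : Fin N := ⟨(q % N).toNat, by omega⟩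
    have hn : ((n : ℕ) : ℤ) = q / N := Int.toNat_of_nonneg hdiv0
    have hi : ((i : ℕ) : ℤ) = q % N := Int.toNat_of_nonneg hmod0
    have hidx : k + m = ((p.1 : ℤ) + (((n : ℕ) : ℤ) - (M + 1)) * N) + ((i : ℕ) : ℤ) := by
      rw [hn, hi]
      have := Int.mul_ediv_add_emod q N
      linarith
    have h := (dist_le_pi_dist _ _ i).trans (hUd _ _ (hx n) _ (hy n)).le
    rw [← cubeDist_eq_dist, ← hidx] at h
    exact h
  · have hx : (x : FullShift a) ∈ {x : FullShift a | ∃ ℓ : ℤ, ∀ n : ℤ,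
        (fun i : Fin N => x (ℓ + n * (N : ℤ) + (i : ℤ))) ∈ K} := hXK ▸ x.2
    obtain ⟨ℓ, hℓ⟩ := hx
    have hmod : ℓ % N < N := Int.emod_lt_of_pos _ hN'
    have hmod0 : 0 ≤ ℓ % N := Int.emod_nonneg _ hN'.ne'
    have hcov : ∀ n : ℤ, ∃ j : Fin P,
        (fun i : Fin N => (x : FullShift a) ((ℓ % N + n * N) + (i : ℤ))) ∈ U j := by
      intro n
      have h := hℓ (n - ℓ / N)
      have he : ℓ + (n - ℓ / N) * N = ℓ % N + n * N := by
        have := Int.mul_ediv_add_emod ℓ N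
        linarith
      rw [he] at h
      exact Set.mem_iUnion.1 (hUK h)
    choose w hw using hcov
    refine Set.mem_iUnion.2 ⟨(⟨(ℓ % N).toNat, by omega⟩, fun n => w ((n : ℤ) - (M + 1))), ?_⟩
    intro n
    have h := hw ((n : ℤ) - (M + 1))
    have ht : (((ℓ % N).toNat : ℕ) : ℤ) = ℓ % N := Int.toNat_of_nonneg hmod0
    simpa only [ht] using h

/-- If `A L ≤ N * P ^ (L / N + b)` for all large `L`, the exponential growth rate of `A`, scaled
by `s`, is at most `log P / s / N`. -/
theorem liminf_log_div_le {A : ℕ → ℕ} {N P b : ℕ} {s : ℝ} (hs : 0 < s)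
    (hA : ∀ L, 0 < L → A L ≤ N * P ^ (L / N + b)) (hb : b ≠ 0) :
    liminf (fun L : ℕ => ((Real.log (A L : ℝ) / (L * s) : ℝ) : EReal)) atTop ≤
      ((Real.log P / s / N : ℝ) : EReal) := by
  set f : ℕ → ℝ := fun L => (Real.log N + b * Real.log P) / s * (L : ℝ)⁻¹ + Real.log P / s / N
  have hf : Tendsto (fun L => (f L : EReal)) atTop (𝓝 ((Real.log P / s / N : ℝ) : EReal)) := by
    refine (continuous_coe_real_ereal.tendsto _).comp ?_
    have := ((tendsto_inv_atTop_nhds_zero_nat (𝕜 := ℝ)).const_mul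
      ((Real.log N + b * Real.log P) / s)).add_const (Real.log P / s / N)
    simpa using this
  rw [← hf.liminf_eq]
  refine liminf_le_liminf ?_
  filter_upwards [eventually_gt_atTop 0] with L hL
  have hP0 := Real.log_natCast_nonneg P
  have hN0 := Real.log_natCast_nonneg N
  have hL' : (0 : ℝ) < L := by exact_mod_cast hL
  have hlog : Real.log (A L) ≤ Real.log N + ((L : ℝ) / N + b) * Real.log P := by
    rcases Nat.eq_zero_or_pos (A L) with h0 | h0
    · rw [h0, Nat.cast_zero, Real.log_zero]
      positivity
    · have hpos := h0.trans_le (hA L hL)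
      have hNn : (N : ℝ) ≠ 0 := by
        rintro h
        simp [Nat.cast_eq_zero.1 h] at hpos
      have hPn : (P : ℝ) ≠ 0 := by
        rintro h
        simp [Nat.cast_eq_zero.1 h, hb] at hpos
      calc Real.log (A L) ≤ Real.log ((N * P ^ (L / N + b) : ℕ) : ℝ) :=
            Real.log_le_log (by exact_mod_cast h0) (by exact_mod_cast hA L hL)
        _ = Real.log N + ((L / N : ℕ) + b : ℝ) * Real.log P := by
            push_cast
            rw [Real.log_mul hNn (pow_ne_zero _ hPn), Real.log_pow]
            push_cast
            ring
        _ ≤ _ := by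
            gcongr
            exact Nat.cast_div_le
  refine EReal.coe_le_coe_iff.2 ?_
  calc Real.log (A L) / (L * s) ≤ (Real.log N + ((L : ℝ) / N + b) * Real.log P) / (L * s) := by
        gcongr
    _ = f L := by
        simp only [f]
        field_simp
        ring

/-- Rescaling the argument by a constant does not increase the logarithmic growth rate. -/
theorem limsup_comp_mul_div_log_le (h : ℝ → ℝ) {c : ℝ} (hc : 0 < c) {N : ℕ} (hN : 0 < N) :
    limsup (fun ε : ℝ => ((h (c * ε) / Real.log (1 / ε) / N : ℝ) : EReal)) (𝓝[>] 0) ≤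
      limsup (fun ε : ℝ => ((h ε / Real.log (1 / ε) : ℝ) : EReal)) (𝓝[>] 0) / (N : EReal) := by
  have hN' : (0 : ℝ) < N := by exact_mod_cast hN
  have hcast : (N : EReal) = ((N : ℝ) : EReal) := rfl
  rw [hcast, EReal.le_div_iff_mul_le (by exact_mod_cast hN') (EReal.coe_ne_top _),
    ← EReal.le_of_forall_lt_iff_le]
  intro z hz
  rw [← EReal.le_div_iff_mul_le (by exact_mod_cast hN') (EReal.coe_ne_top _), ← EReal.coe_div]
  have hmul : Tendsto (fun ε : ℝ => c * ε) (𝓝[>] 0) (𝓝[>] 0) := by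
    refine tendsto_nhdsWithin_iff.2 ⟨?_, ?_⟩
    · have h1 : Tendsto (fun ε : ℝ => c * ε) (𝓝 0) (𝓝 (c * 0)) := tendsto_id.const_mul c
      rw [mul_zero] at h1
      exact h1.mono_left nhdsWithin_le_nhds
    · filter_upwards [self_mem_nhdsWithin] with ε hε
      exact mul_pos hc hε
  have hlog : Tendsto (fun ε : ℝ => Real.log (1 / ε)) (𝓝[>] 0) atTop := by
    simp only [one_div]
    exact Real.tendsto_log_atTop.comp tendsto_inv_nhdsGT_zero
  have hlim : Tendsto (fun ε : ℝ => ((z / N * (1 + Real.log (1 / c) * (Real.log (1 / ε))⁻¹) : ℝ) :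
      EReal)) (𝓝[>] 0) (𝓝 ((z / N : ℝ) : EReal)) := by
    refine (continuous_coe_real_ereal.tendsto _).comp ?_
    have := (((tendsto_inv_atTop_zero.comp hlog).const_mul (Real.log (1 / c))).const_add 1).const_mul
      (z / N)
    simpa using this
  rw [← hlim.limsup_eq]
  refine limsup_le_limsup ?_
  filter_upwards [hmul.eventually (eventually_lt_of_limsup_lt hz), hlog.eventually_gt_atTop 0,
    (hlog.comp hmul).eventually_gt_atTop 0, self_mem_nhdsWithin] with ε h1 h2 h3 h4
  have h4' : (0 : ℝ) < ε := h4
  have h3' : 0 < Real.log (1 / (c * ε)) := h3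
  have h5 : h (c * ε) < z * Real.log (1 / (c * ε)) :=
    (div_lt_iff₀ h3').1 (EReal.coe_lt_coe_iff.1 h1)
  have h6 : Real.log (1 / (c * ε)) = Real.log (1 / c) + Real.log (1 / ε) := by
    rw [← Real.log_mul (by positivity) (by positivity)]
    congr 1
    field_simp
  rw [h6] at h5
  refine EReal.coe_le_coe_iff.2 ?_
  calc h (c * ε) / Real.log (1 / ε) / N
      ≤ z * (Real.log (1 / c) + Real.log (1 / ε)) / Real.log (1 / ε) / N := by gcongr
    _ = _ := by
      field_simp
      ring

/-- for a closed `K ⊆ ([0,1]^a)^N`, the block-system `X(K)` satisfies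
`upper-mdim_M(X(K), σ, D) ≤ upper-dim_M(K, ‖·‖_∞) / N`, where the upper Minkowski
dimension is `limsup_{ε→0} log #(K, ‖·‖_∞, ε)/log(1/ε)`. -/
theorem stmt_18 (a N : ℕ) (hN : 0 < N) (K : Set (Fin N → Cube a)) (hK : IsClosed K)
    (XK : Set (FullShift a))
    (hXK : XK = {x : FullShift a | ∃ ℓ : ℤ, ∀ n : ℤ,
      (fun i : Fin N => x (ℓ + n * (N : ℤ) + (i : ℤ))) ∈ K}) :
    ∀ T : XK → XK, (∀ x : XK, (T x : FullShift a) = shift (x : FullShift a)) →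
      upperMdimM T (fun x y : XK => shiftDist (x : FullShift a) (y : FullShift a)) ≤
        (Filter.limsup (fun ε : ℝ =>
          ((Real.log (covNum
              (fun u v : Fin N → Cube a =>
                ‖(fun i j => ((u i j : ℝ))) - (fun i j => ((v i j : ℝ)))‖) ε K : ℝ) /
            Real.log (1 / ε) : ℝ) : EReal))
          (𝓝[>] (0 : ℝ))) / (N : EReal) := by
  intro T hT
  simp only [norm_block_sub_eq_dist]
  obtain ⟨c, hc, hcM⟩ := exists_shiftDist_le
  refine le_trans (limsup_le_limsup ?_) (limsup_comp_mul_div_log_le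
    (fun ε => Real.log (covNum (fun u v : Fin N → Cube a => dist u v) ε K : ℝ)) hc hN)
  filter_upwards [Ioo_mem_nhdsGT (zero_lt_one (α := ℝ))] with ε hε
  obtain ⟨M, hM⟩ := hcM ε hε.1
  exact liminf_log_div_le (b := 2 * M + 2) (Real.log_pos ((one_lt_div hε.1).2 hε.2))
    (fun L hL => covNum_blockSystem_le hN hK.isCompact hXK hT hε.1 (mul_pos hc hε.1) (hM a) hL)
    (Nat.succ_ne_zero _)
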